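/- Let H : ℝ → ℝ be continuous and coercive with H(p) = |p − 1| − 1 for p ∈ [0,2] and H(p) ≥ 0 for p ∉ [0,2]. Then for every k > 0 the function u_k(x) = e^{x − k}, x ∈ [−k, k], is the unique state-constraint viscosity solution of u(x) + H(u'(x)) = 0 on (−k, k). Consequently u_k(k) = 1 for every k, e^{−2k} ≤ u_k(x) ≤ e^{|x| − k} for all x ∈ [−k, k], and u_k → 0 locally uniformly on ℝ as k → ∞, where u ≡ 0 is the unique bounded viscosity solution of u + H(u') = 0 in ℝ. -/

import Mathlib

open Metric Set MeasureTheory Filter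
open scoped Topology NNReal

noncomputable section

/-- `v` is a viscosity subsolution of `v + H(x, v') = 0` in the open set `Ω ⊆ ℝ`. -/
def IsViscositySubsolutionIn1 (Ω : Set ℝ) (H : ℝ → ℝ → ℝ) (v : ℝ → ℝ) : Prop :=
  ∀ x ∈ Ω, ∀ φ : ℝ → ℝ, ContDiff ℝ 1 φ →
    IsLocalMaxOn (fun y => v y - φ y) Ω x → v x + H x (deriv φ x) ≤ 0

/-- `v` is a viscosity supersolution of `v + H(x, v') = 0` on the closure of `Ω ⊆ ℝ`. -/
def IsViscositySupersolutionOn1 (Ω : Set ℝ) (H : ℝ → ℝ → ℝ) (v : ℝ → ℝ) : Prop :=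
  ∀ x ∈ closure Ω, ∀ φ : ℝ → ℝ, ContDiff ℝ 1 φ →
    IsLocalMinOn (fun y => v y - φ y) (closure Ω) x → 0 ≤ v x + H x (deriv φ x)

/-- `v` is a state-constraint viscosity solution on `Ω ⊆ ℝ`. -/
def IsStateConstraintSolution1 (Ω : Set ℝ) (H : ℝ → ℝ → ℝ) (v : ℝ → ℝ) : Prop :=
  ContinuousOn v (closure Ω) ∧ IsViscositySubsolutionIn1 Ω H v ∧
    IsViscositySupersolutionOn1 Ω H v

lemma aux_H_lower {H : ℝ → ℝ} (hHin : ∀ p ∈ Icc (0:ℝ) 2, H p = |p - 1| - 1)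
    (hHout : ∀ p : ℝ, p ∉ Icc (0:ℝ) 2 → 0 ≤ H p) (p w : ℝ) (hw : 0 ≤ w) (hpw : p ≤ w) :
    -w ≤ H p := by
  by_cases hp : p ∈ Icc (0:ℝ) 2
  · rw [hHin p hp]
    have := neg_abs_le (p - 1)
    linarith
  · linarith [hHout p hp]

lemma aux_H_ge {H : ℝ → ℝ} (hHin : ∀ p ∈ Icc (0:ℝ) 2, H p = |p - 1| - 1)
    (hHout : ∀ p : ℝ, p ∉ Icc (0:ℝ) 2 → 0 ≤ H p) (p : ℝ) : -1 ≤ H p := by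
  by_cases hp : p ∈ Icc (0:ℝ) 2
  · rw [hHin p hp]
    have := abs_nonneg (p - 1)
    linarith
  · linarith [hHout p hp]

lemma aux_H_eq {H : ℝ → ℝ} (hHin : ∀ p ∈ Icc (0:ℝ) 2, H p = |p - 1| - 1)
    (p : ℝ) (h0 : 0 ≤ p) (h1 : p ≤ 1) : H p = -p := by
  rw [hHin p ⟨h0, by linarith⟩, abs_of_nonpos (by linarith)]
  ring

lemma aux_closure {k : ℝ} (hk : 0 < k) : closure (Ioo (-k) k) = Icc (-k) k :=
  closure_Ioo (by linarith)

lemma aux_hasDeriv_exp (k x : ℝ) :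
    HasDerivAt (fun x => Real.exp (x - k)) (Real.exp (x - k)) x := by
  simpa using ((hasDerivAt_id x).sub_const k).exp

lemma aux_exp_sol {H : ℝ → ℝ}
    (hHin : ∀ p ∈ Icc (0:ℝ) 2, H p = |p - 1| - 1)
    (hHout : ∀ p : ℝ, p ∉ Icc (0:ℝ) 2 → 0 ≤ H p) (k : ℝ) (hk : 0 < k) :
    IsStateConstraintSolution1 (Ioo (-k) k) (fun _ p => H p)
        (fun x => Real.exp (x - k)) := by
  refine ⟨by fun_prop, ?_, ?_⟩
  · intro x hx φ hφ hmax
    have hm := hmax.isLocalMax (isOpen_Ioo.mem_nhds hx)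
    have hd := (aux_hasDeriv_exp k x).sub (hφ.differentiable one_ne_zero x).hasDerivAt
    have h0 := hm.hasDerivAt_eq_zero hd
    have h1 : deriv φ x = Real.exp (x - k) := by linarith
    have := aux_H_eq hHin (Real.exp (x - k)) (Real.exp_pos _).le
      (Real.exp_le_one_iff.2 (by linarith [hx.2]))
    simp only [h1, this]
    linarith
  · intro x hx φ hφ hmin
    rw [aux_closure hk] at hx hmin
    have hd := (aux_hasDeriv_exp k x).sub (hφ.differentiable one_ne_zero x).hasDerivAt
    rcases eq_or_lt_of_le hx.2 with h | h
    · have := aux_H_ge hHin hHout (deriv φ x)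
      subst h
      simp only [sub_self, Real.exp_zero]
      linarith
    · have hseg : segment ℝ x (x + (k - x)) ⊆ Icc (-k) k := by
        rw [segment_eq_Icc (by linarith)]
        exact Icc_subset_Icc hx.1 (by linarith)
      have h0 := hmin.hasFDerivWithinAt_nonneg hd.hasFDerivAt.hasFDerivWithinAt
        (mem_posTangentConeAt_of_segment_subset hseg)
      have h0' : 0 ≤ (k - x) * (Real.exp (x - k) - deriv φ x) := by simpa using h0
      have h1 : deriv φ x ≤ Real.exp (x - k) := by
        have := nonneg_of_mul_nonneg_right h0' (by linarith)
        linarith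
      have := aux_H_lower hHin hHout _ _ (Real.exp_pos _).le h1
      show 0 ≤ Real.exp (x - k) + H (deriv φ x)
      linarith

lemma aux_lim (c d : ℝ) (hd : 0 < d) :
    Tendsto (fun N : ℝ => c * Real.exp (-(N * d))) atTop (𝓝 0) := by
  have h : Tendsto (fun N : ℝ => N * d) atTop atTop := tendsto_id.atTop_mul_const hd
  simpa using (Real.tendsto_exp_neg_atTop_nhds_zero.comp h).const_mul c

lemma aux_le_one {H : ℝ → ℝ}
    (hHin : ∀ p ∈ Icc (0:ℝ) 2, H p = |p - 1| - 1)
    (hHout : ∀ p : ℝ, p ∉ Icc (0:ℝ) 2 → 0 ≤ H p) (k : ℝ) (hk : 0 < k) (v : ℝ → ℝ)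
    (hc : ContinuousOn v (Icc (-k) k)) (c : ℝ) (hcb : ∀ x ∈ Icc (-k) k, v x ≤ c) (hc0 : 0 ≤ c)
    (hsub : IsViscositySubsolutionIn1 (Ioo (-k) k) (fun _ p => H p) v) :
    ∀ x ∈ Icc (-k) k, v x ≤ 1 := by
  have hint : ∀ x ∈ Ioo (-k) k, v x ≤ 1 := by
    intro x hx
    have key : ∀ N : ℝ, v x ≤ 1 + (c * Real.exp (-(N * (x + k))) + c * Real.exp (-(N * (k - x)))) := by
      intro N
      set φ : ℝ → ℝ := fun y => 1 + (c * Real.exp (-(N * (y + k))) + c * Real.exp (-(N * (k - y))))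
        with hφ
      have hφc : ContDiff ℝ 1 φ := by fun_prop
      obtain ⟨z, hz, hzm⟩ := isCompact_Icc.exists_isMaxOn (nonempty_Icc.2 (by linarith : -k ≤ k))
        (hc.sub hφc.continuous.continuousOn)
      have hxz : v x - φ x ≤ v z - φ z := hzm (Ioo_subset_Icc_self hx)
      have p1 : 0 ≤ c * Real.exp (-(N * (z + k))) := by positivity
      have p2 : 0 ≤ c * Real.exp (-(N * (k - z))) := by positivity
      have hzn : v z - φ z ≤ 0 := by
        rcases eq_or_lt_of_le hz.1 with h | h
        · have := hcb z hz
          have e : c * Real.exp (-(N * (z + k))) = c := by rw [← h]; simp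
          simp only [hφ]; linarith
        rcases eq_or_lt_of_le hz.2 with h' | h'
        · have := hcb z hz
          have e : c * Real.exp (-(N * (k - z))) = c := by rw [h']; simp
          simp only [hφ]; linarith
        have := hsub z ⟨h, h'⟩ φ hφc ((hzm.on_subset Ioo_subset_Icc_self).localize)
        have h2 := aux_H_ge hHin hHout (deriv φ z)
        simp only at this
        simp only [hφ]; linarith
      linarith
    have hl := ((aux_lim c (x + k) (by linarith [hx.1])).add
      (aux_lim c (k - x) (by linarith [hx.2]))).const_add 1
    have := ge_of_tendsto' hl key
    linarith
  intro x hx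
  rw [← aux_closure hk] at hx hc
  exact le_on_closure hint hc continuousOn_const hx

lemma aux_unique {H : ℝ → ℝ}
    (hHin : ∀ p ∈ Icc (0:ℝ) 2, H p = |p - 1| - 1)
    (hHout : ∀ p : ℝ, p ∉ Icc (0:ℝ) 2 → 0 ≤ H p) (k : ℝ) (hk : 0 < k) (v : ℝ → ℝ)
    (hv : IsStateConstraintSolution1 (Ioo (-k) k) (fun _ p => H p) v) :
    EqOn v (fun x => Real.exp (x - k)) (Icc (-k) k) := by
  obtain ⟨hc, hsub, hsup⟩ := hv
  have hc' := hc
  unfold IsViscositySupersolutionOn1 at hsup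
  rw [aux_closure hk] at hc hsup
  have hne : (Icc (-k) k).Nonempty := nonempty_Icc.2 (by linarith)
  have hwc : ContDiff ℝ 1 (fun x : ℝ => Real.exp (x - k)) := by fun_prop
  have hge : ∀ x ∈ Icc (-k) k, Real.exp (x - k) ≤ v x := by
    intro x hx
    obtain ⟨z, hz, hzm⟩ := isCompact_Icc.exists_isMinOn hne
      (hc.sub hwc.continuous.continuousOn)
    have hxz : v z - Real.exp (z - k) ≤ v x - Real.exp (x - k) := hzm hx
    have h := hsup z hz _ hwc hzm.localize
    simp only [(aux_hasDeriv_exp k z).deriv] at h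
    rw [aux_H_eq hHin _ (Real.exp_pos _).le (Real.exp_le_one_iff.2 (by linarith [hz.2]))] at h
    linarith
  obtain ⟨m, hm, hmm⟩ := isCompact_Icc.exists_isMaxOn hne hc
  have hc0 : 0 ≤ v m := (Real.exp_pos _).le.trans (hge m hm)
  have hcb : ∀ x ∈ Icc (-k) k, v x ≤ v m := fun x hx => hmm hx
  have hle1 := aux_le_one hHin hHout k hk v hc (v m) hcb hc0 hsub
  have hint : ∀ x ∈ Ioo (-k) k, v x ≤ Real.exp (x - k) := by
    intro x hx
    have key : ∀ N : ℝ, 0 < N → v x ≤ Real.exp (x - k) + 1 * Real.exp (-(N * (x + k))) := by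
      intro N hN
      set φ : ℝ → ℝ := fun y => Real.exp (y - k) + 1 * Real.exp (-(N * (y + k)))
        with hφ
      have hφc : ContDiff ℝ 1 φ := by fun_prop
      obtain ⟨z, hz, hzm⟩ := isCompact_Icc.exists_isMaxOn hne
        (hc.sub hφc.continuous.continuousOn)
      have hxz : v x - φ x ≤ v z - φ z := hzm (Ioo_subset_Icc_self hx)
      have p1 : 0 < Real.exp (-(N * (z + k))) := by positivity
      have p2 : 0 < Real.exp (z - k) := by positivity
      have hzn : v z - φ z ≤ 0 := by
        have h1 := hle1 z hz
        rcases eq_or_lt_of_le hz.1 with h | h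
        · have e : Real.exp (-(N * (z + k))) = 1 := by rw [← h]; simp
          simp only [hφ]; linarith
        rcases eq_or_lt_of_le hz.2 with h' | h'
        · have e : Real.exp (z - k) = 1 := by rw [h']; simp
          simp only [hφ]; linarith
        have := hsub z ⟨h, h'⟩ φ hφc ((hzm.on_subset Ioo_subset_Icc_self).localize)
        have hd : HasDerivAt φ (Real.exp (z - k) + 1 * (Real.exp (-(N * (z + k))) * (-(N * 1)))) z :=
          (aux_hasDeriv_exp k z).add
            (((((hasDerivAt_id z).add_const k).const_mul N).neg.exp).const_mul 1)
        have h2 := aux_H_lower hHin hHout (deriv φ z) (Real.exp (z - k)) p2.le (by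
          rw [hd.deriv]; nlinarith [mul_pos p1 hN])
        simp only at this
        simp only [hφ]; linarith
      linarith
    have hl := (aux_lim 1 (x + k) (by linarith [hx.1])).const_add (Real.exp (x - k))
    have := ge_of_tendsto hl ((eventually_gt_atTop 0).mono key)
    linarith
  intro x hx
  refine le_antisymm ?_ (hge x hx)
  rw [← aux_closure hk] at hx
  exact le_on_closure hint hc' hwc.continuous.continuousOn hx

lemma aux_tendsto : TendstoLocallyUniformly (fun (k : ℝ) (x : ℝ) => Real.exp (x - k))
    (fun _ => (0:ℝ)) atTop := by
  rw [Metric.tendstoLocallyUniformly_iff]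
  intro ε hε x
  refine ⟨Iio (x + 1), Iio_mem_nhds (by linarith), ?_⟩
  have h := aux_lim (Real.exp (x + 1)) 1 one_pos
  filter_upwards [h.eventually_lt_const hε] with k hk y hy
  rw [dist_zero_left, Real.norm_of_nonneg (Real.exp_pos _).le]
  refine lt_of_le_of_lt ?_ hk
  rw [← Real.exp_add]
  apply Real.exp_le_exp.2
  have : y < x + 1 := hy
  linarith

lemma aux_sqrt_deriv (ε x : ℝ) :
    HasDerivAt (fun y : ℝ => ε * √(1 + y ^ 2)) (ε * (x / √(1 + x ^ 2))) x := by
  have h : HasDerivAt (fun y : ℝ => 1 + y ^ 2) (2 * x) x := by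
    simpa using (hasDerivAt_pow 2 x).const_add 1
  have h2 := (h.sqrt (by positivity)).const_mul ε
  rwa [mul_div_mul_left _ _ (two_ne_zero)] at h2

lemma aux_sqrt_bound (x : ℝ) : |x / √(1 + x ^ 2)| ≤ 1 := by
  rw [abs_div, abs_of_nonneg (Real.sqrt_nonneg _)]
  apply div_le_one_of_le₀ _ (Real.sqrt_nonneg _)
  apply Real.abs_le_sqrt
  linarith

lemma aux_sqrt_contDiff (ε : ℝ) : ContDiff ℝ 1 (fun y : ℝ => ε * √(1 + y ^ 2)) := by
  refine contDiff_const.mul (ContDiff.sqrt (by fun_prop) ?_)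
  intro x
  positivity

lemma aux_exists_min (v : ℝ → ℝ) (hv : Continuous v) (M : ℝ) (hM : ∀ x, |v x| ≤ M) (ε : ℝ)
    (hε : 0 < ε) : ∃ z, ∀ x, v z + ε * √(1 + z ^ 2) ≤ v x + ε * √(1 + x ^ 2) := by
  have hcont : Continuous (fun x => v x + ε * √(1 + x ^ 2)) :=
    hv.add (aux_sqrt_contDiff ε).continuous
  apply hcont.exists_forall_le
  have h1 : Tendsto (fun x : ℝ => -M + ε * ‖x‖) (cocompact ℝ) atTop :=
    tendsto_atTop_add_const_left _ _ ((tendsto_norm_cocompact_atTop (E := ℝ)).const_mul_atTop hε)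
  refine tendsto_atTop_mono (fun x => ?_) h1
  have := neg_le_of_abs_le (hM x)
  have h2 : |x| ≤ √(1 + x ^ 2) := Real.abs_le_sqrt (by linarith)
  have := mul_le_mul_of_nonneg_left h2 hε.le
  simp only [Real.norm_eq_abs]
  linarith

lemma aux_small {H : ℝ → ℝ} (hH : Continuous H) (h0 : H 0 = 0) (δ : ℝ) (hδ : 0 < δ) :
    ∃ r > 0, ∀ p, |p| < r → |H p| < δ := by
  obtain ⟨r, hr, h⟩ := Metric.continuous_iff.1 hH 0 δ hδ
  refine ⟨r, hr, fun p hp => ?_⟩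
  have := h p (by simpa using hp)
  simpa [h0, Real.dist_eq] using this

lemma aux_eps (a b : ℝ) (h : ∀ δ > 0, ∃ r > 0, ∀ ε > 0, ε < r → a ≤ δ + ε * b) : a ≤ 0 := by
  apply le_of_forall_pos_le_add
  intro δ hδ
  obtain ⟨r, hr, h⟩ := h δ hδ
  have hl : Tendsto (fun ε : ℝ => δ + ε * b) (𝓝[>] 0) (𝓝 (δ + 0 * b)) :=
    (Continuous.tendsto (by fun_prop : Continuous fun ε : ℝ => δ + ε * b) 0).mono_left
      nhdsWithin_le_nhds
  have := ge_of_tendsto hl (by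
    filter_upwards [Ioo_mem_nhdsGT hr] with ε hε using h ε hε.1 hε.2)
  linarith

lemma aux_line {H : ℝ → ℝ} (hH : Continuous H) (h0 : H 0 = 0) (v : ℝ → ℝ) (hv : Continuous v)
    (M : ℝ) (hM : ∀ x, |v x| ≤ M)
    (hsub : IsViscositySubsolutionIn1 univ (fun _ p => H p) v)
    (hsup : IsViscositySupersolutionOn1 univ (fun _ p => H p) v) (x : ℝ) : v x = 0 := by
  have hb : ∀ ε r z : ℝ, |ε| < r → |ε * (z / √(1 + z ^ 2))| < r := by
    intro ε r z h
    rw [abs_mul]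
    have := mul_le_mul_of_nonneg_left (aux_sqrt_bound z) (abs_nonneg ε)
    linarith
  apply le_antisymm
  · apply aux_eps _ (√(1 + x ^ 2))
    intro δ hδ
    obtain ⟨r, hr, h⟩ := aux_small hH h0 δ hδ
    refine ⟨r, hr, fun ε hε hεr => ?_⟩
    obtain ⟨z, hz⟩ := aux_exists_min (fun y => - v y) hv.neg M (by simpa using hM) ε hε
    have h1 := hsub z (mem_univ z) _ (aux_sqrt_contDiff ε) (by
      apply IsMaxOn.localize
      intro y _
      have := hz y
      show v y - ε * √(1 + y ^ 2) ≤ v z - ε * √(1 + z ^ 2)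
      linarith)
    simp only [(aux_sqrt_deriv ε z).deriv] at h1
    have h2 := neg_abs_le (H (ε * (z / √(1 + z ^ 2))))
    have h3 := h _ (hb ε r z (by rwa [abs_of_pos hε]))
    have h4 := hz x
    have h5 : 0 ≤ ε * √(1 + z ^ 2) := by positivity
    linarith
  · suffices h : - v x ≤ 0 by linarith
    apply aux_eps _ (√(1 + x ^ 2))
    intro δ hδ
    obtain ⟨r, hr, h⟩ := aux_small hH h0 δ hδ
    refine ⟨r, hr, fun ε hε hεr => ?_⟩
    obtain ⟨z, hz⟩ := aux_exists_min v hv M hM ε hε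
    have h1 := hsup z (by simp) _ (aux_sqrt_contDiff (-ε)) (by
      apply IsMinOn.localize
      intro y _
      have := hz y
      show v z - -ε * √(1 + z ^ 2) ≤ v y - -ε * √(1 + y ^ 2)
      linarith)
    simp only [(aux_sqrt_deriv (-ε) z).deriv] at h1
    have h2 := le_abs_self (H (-ε * (z / √(1 + z ^ 2))))
    have h3 := h _ (hb (-ε) r z (by rwa [abs_neg, abs_of_pos hε]))
    have h4 := hz x
    have h5 : 0 ≤ ε * √(1 + z ^ 2) := by positivity
    linarith

lemma aux_zero_deriv (φ : ℝ → ℝ) (x : ℝ) (h : IsLocalExtr (fun y => (0:ℝ) - φ y) x) :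
    deriv φ x = 0 := by
  have h2 := h.deriv_eq_zero
  simpa [deriv.fun_neg] using h2

/-- Proposition 5.12: for `H(p) = |p-1| - 1` on `[0,2]`, `H ≥ 0` outside, the function
`u_k(x) = e^{x-k}` is the unique state-constraint solution on `(-k,k)`; consequences on
rates and the limit `u ≡ 0`. -/
theorem one_d_example_exp {H : ℝ → ℝ} (hHcont : Continuous H)
    (hHcoer : ∀ M : ℝ, ∃ R : ℝ, ∀ p : ℝ, R ≤ |p| → M ≤ H p)
    (hHin : ∀ p ∈ Icc (0:ℝ) 2, H p = |p - 1| - 1)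
    (hHout : ∀ p : ℝ, p ∉ Icc (0:ℝ) 2 → 0 ≤ H p) :
    (∀ k : ℝ, 0 < k →
      (IsStateConstraintSolution1 (Ioo (-k) k) (fun _ p => H p)
        (fun x => Real.exp (x - k)) ∧
      (∀ v : ℝ → ℝ, IsStateConstraintSolution1 (Ioo (-k) k) (fun _ p => H p) v →
        EqOn v (fun x => Real.exp (x - k)) (Icc (-k) k)) ∧
      Real.exp (k - k) = 1 ∧
      ∀ x ∈ Icc (-k) k,
        Real.exp (-(2 * k)) ≤ Real.exp (x - k) ∧ Real.exp (x - k) ≤ Real.exp (|x| - k))) ∧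
    TendstoLocallyUniformly (fun (k : ℝ) (x : ℝ) => Real.exp (x - k)) (fun _ => (0:ℝ))
      atTop ∧
    (IsViscositySubsolutionIn1 univ (fun _ p => H p) (fun _ => (0:ℝ)) ∧
      IsViscositySupersolutionOn1 univ (fun _ p => H p) (fun _ => (0:ℝ))) ∧
    (∀ v : ℝ → ℝ, Continuous v → (∃ M : ℝ, ∀ x, |v x| ≤ M) →
      IsViscositySubsolutionIn1 univ (fun _ p => H p) v →
      IsViscositySupersolutionOn1 univ (fun _ p => H p) v → ∀ x, v x = 0) := by
  have h0 : H 0 = 0 := by simpa using aux_H_eq hHin 0 le_rfl zero_le_one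
  refine ⟨fun k hk => ⟨aux_exp_sol hHin hHout k hk, aux_unique hHin hHout k hk, by simp, ?_⟩,
    aux_tendsto, ⟨?_, ?_⟩, ?_⟩
  · intro x hx
    exact ⟨Real.exp_le_exp.2 (by linarith [hx.1]),
      Real.exp_le_exp.2 (by linarith [le_abs_self x])⟩
  · intro x _ φ hφ hm
    have := aux_zero_deriv φ x (Or.inr (hm.isLocalMax univ_mem))
    simp [this, h0]
  · intro x _ φ hφ hm
    rw [closure_univ] at hm
    have := aux_zero_deriv φ x (Or.inl (hm.isLocalMin univ_mem))
    simp [this, h0]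
  · rintro v hv ⟨M, hM⟩ hsub hsup x
    exact aux_line hHcont h0 v hv M hM hsub hsup x
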